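/- arXiv:1602.08965 — 3 statements merged into one kernel-verified Lean document; each statement's English description precedes it below -/
import Mathlib

section
/- Every 132-representable finite simple graph is a circle graph; that is, if G is 132-representable, then there exists a 2-uniform word w (each letter of A(w) occurs exactly twice in w) that represents a finite simple graph isomorphic to G. -/
/-- Distinct letters `x` and `y` alternate in the word `w`: the subsequence of `w`
formed by all occurrences of `x` and `y` has no two equal consecutive letters. -/
def Alternate (w : List ℕ) (x y : ℕ) : Prop :=
  (w.filter (fun c => decide (c = x ∨ c = y))).Chain' (· ≠ ·)

/-- The word `w` avoids the pattern 132. -/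
def Avoids132 (w : List ℕ) : Prop :=
  ∀ i j k : Fin w.length, i < j → j < k →
    ¬ (w.get i < w.get k ∧ w.get k < w.get j)

/-- The word `w` represents the simple graph `G`: the vertex set of `G` is the set
`A(w)` of letters of `w` (all other vertices of the ambient type `ℕ` are isolated),
and two distinct letters of `w` are adjacent iff they alternate in `w`. -/
def Represents (w : List ℕ) (G : SimpleGraph ℕ) : Prop :=
  (∀ x y, G.Adj x y → x ∈ w) ∧
  (∀ x y : ℕ, x ≠ y → x ∈ w → y ∈ w → (G.Adj x y ↔ Alternate w x y))

/-- A graph is 132-representable if some simple graph on a set of natural numbers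
isomorphic to it is represented by a 132-avoiding word. -/
def Representable132 {V : Type*} (G : SimpleGraph V) : Prop :=
  ∃ (w : List ℕ) (H : SimpleGraph ℕ), Avoids132 w ∧ Represents w H ∧
    Nonempty (G ≃g H.induce (↑w.toFinset : Set ℕ))

theorem Alternate.symm {w : List ℕ} {x y : ℕ} (h : Alternate w x y) : Alternate w y x := by
  unfold Alternate at *
  simpa only [or_comm] using h

theorem alternate_comm {w : List ℕ} {x y : ℕ} : Alternate w x y ↔ Alternate w y x :=
  ⟨Alternate.symm, Alternate.symm⟩

/-- If `x` and `y` alternate, then `y` occurs between any two occurrences of `x`. -/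
theorem Alternate.mem_between {a b c : List ℕ} {x y : ℕ}
    (h : Alternate (a ++ x :: b ++ x :: c) x y) : y ∈ b := by
  by_contra hy
  unfold Alternate at h
  have hb : b.filter (fun c => decide (c = x ∨ c = y)) =
      List.replicate (b.count x) x := by
    rw [← List.filter_eq]
    refine List.filter_congr fun c hc => ?_
    have : c ≠ y := fun e => hy (e ▸ hc)
    simp [this, eq_comm]
  have h2 : (x :: (List.replicate (b.count x) x ++ [x])).IsChain (· ≠ ·) := by
    refine List.IsChain.infix h ?_
    refine ⟨a.filter (fun c => decide (c = x ∨ c = y)),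
      c.filter (fun c => decide (c = x ∨ c = y)), ?_⟩
    simp [List.filter_append, ← hb]
  cases hn : b.count x <;> rw [hn] at h2 <;> simp [List.replicate_succ] at h2

theorem Avoids132.not_sublist {w : List ℕ} (hw : Avoids132 w) {p q r : ℕ} (hpr : p < r)
    (hrq : r < q) : ¬ [p, q, r].Sublist w := by
  intro h
  obtain ⟨f, hf⟩ := List.sublist_iff_exists_fin_orderEmbedding_get_eq.1 h
  have h0 := hf ⟨0, by simp⟩
  have h1 := hf ⟨1, by simp⟩
  have h2 := hf ⟨2, by simp⟩
  simp only [List.get_eq_getElem, List.getElem_cons_zero, List.getElem_cons_succ] at h0 h1 h2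
  refine hw _ _ _ (f.lt_iff_lt.2 (show (⟨0, by simp⟩ : Fin [p, q, r].length) < ⟨1, by simp⟩ by
    simp)) (f.lt_iff_lt.2 (show (⟨1, by simp⟩ : Fin [p, q, r].length) < ⟨2, by simp⟩ by
    simp)) ⟨?_, ?_⟩ <;> simp only [List.get_eq_getElem] <;> omega

theorem exists_eq_append_of_three_le_count {w : List ℕ} {x : ℕ} (h : 3 ≤ w.count x) :
    ∃ a b c d, w = a ++ x :: b ++ x :: c ++ x :: d := by
  obtain ⟨a, w₁, rfl, ha⟩ := List.eq_append_cons_of_mem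
    (List.count_pos_iff.1 (show 0 < w.count x by omega))
  have ha' := List.count_eq_zero_of_not_mem ha
  simp only [List.count_append, List.count_cons_self, ha'] at h
  obtain ⟨b, w₂, rfl, hb⟩ := List.eq_append_cons_of_mem
    (List.count_pos_iff.1 (show 0 < w₁.count x by omega))
  have hb' := List.count_eq_zero_of_not_mem hb
  simp only [List.count_append, List.count_cons_self, hb'] at h
  obtain ⟨c, d, rfl⟩ := List.append_of_mem
    (List.count_pos_iff.1 (show 0 < w₂.count x by omega))
  exact ⟨a, b, c, d, by simp⟩

/-- In a 132-avoiding word, a letter occurring at least three times alternates with at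
most one other letter. -/
theorem Avoids132.eq_of_alternate {w : List ℕ} (hw : Avoids132 w) {x y z : ℕ}
    (hx : 3 ≤ w.count x) (hyx : y ≠ x) (hzx : z ≠ x) (hy : Alternate w x y)
    (hz : Alternate w x z) : y = z := by
  obtain ⟨a, b, c, d, rfl⟩ := exists_eq_append_of_three_le_count hx
  have mem_first : ∀ {t}, Alternate (a ++ x :: b ++ x :: c ++ x :: d) x t → t ∈ b := fun h =>
    Alternate.mem_between (a := a) (c := c ++ x :: d) (by simpa using h)
  have mem_second : ∀ {t}, Alternate (a ++ x :: b ++ x :: c ++ x :: d) x t → t ∈ c := fun h =>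
    Alternate.mem_between (a := a ++ x :: b) (c := d) (by simpa using h)
  have sub₁ : ∀ {s t}, s ∈ b → t ∈ c →
      [x, s, x, t, x].Sublist (a ++ x :: b ++ x :: c ++ x :: d) := by
    intro s t hs ht
    have h := ((List.singleton_sublist.2 hs).cons_cons x).append
      (((List.singleton_sublist.2 ht).cons_cons x).append
        ((List.nil_sublist d).cons_cons x))
    have h' := h.trans (List.sublist_append_right a _)
    simpa using h'
  have hyb := mem_first hy
  have hyc := mem_second hy
  have hzb := mem_first hz
  have hzc := mem_second hz
  have key : ∀ {s t}, s ≠ x → t ≠ x → s ∈ b → s ∈ c → t ∈ b → t ∈ c → ¬ s < t := by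
    intro s t hsx htx hsb hsc htb htc hst
    rcases lt_or_gt_of_ne hsx with h1 | h1
    · rcases lt_or_gt_of_ne htx with h2 | h2
      · exact hw.not_sublist hst h2 (List.Sublist.trans (by
          exact List.Sublist.cons _ (.cons_cons _ (.cons_cons _ (.cons_cons _ (.cons _ .slnil)))))
          (sub₁ hsb htc))
      · exact hw.not_sublist h1 h2 (List.Sublist.trans (by
          exact List.Sublist.cons _ (.cons_cons _ (.cons _ (.cons_cons _ (.cons_cons _ .slnil)))))
          (sub₁ hsb htc))
    · exact hw.not_sublist h1 hst (List.Sublist.trans (by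
          exact List.Sublist.cons_cons _ (.cons_cons _ (.cons _ (.cons_cons _ (.cons _ .slnil)))))
          (sub₁ htb hsc))
  have h1 := key hyx hzx hyb hyc hzb hzc
  have h2 := key hzx hyx hzb hzc hyb hyc
  omega

theorem length_eq_count_add_count {l : List ℕ} {x y : ℕ} (hxy : x ≠ y)
    (hl : ∀ c ∈ l, c = x ∨ c = y) : l.length = l.count x + l.count y := by
  induction l with
  | nil => simp
  | cons a l ih =>
    have := ih fun c hc => hl c (List.mem_cons_of_mem _ hc)
    rcases hl a List.mem_cons_self with rfl | rfl
    · simp [hxy]; omega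
    · simp [hxy.symm]; omega

/-- The word obtained from `w` by removing letters that occur more than twice and repeating
at the end the letters that occur once. -/
def twoUniformCompletion (w : List ℕ) : List ℕ :=
  w.filter (fun c => decide (w.count c ≤ 2)) ++ w.filter (fun c => decide (w.count c = 1))

theorem mem_twoUniformCompletion {w : List ℕ} {x : ℕ} :
    x ∈ twoUniformCompletion w ↔ x ∈ w ∧ w.count x ≤ 2 := by
  simp only [twoUniformCompletion, List.mem_append, List.mem_filter, decide_eq_true_eq]
  constructor
  · rintro (h | h)
    · exact h
    · exact ⟨h.1, by omega⟩
  · exact Or.inl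

theorem count_filter_ite (w : List ℕ) (p : ℕ → Bool) (x : ℕ) :
    (w.filter p).count x = if p x then w.count x else 0 := by
  split_ifs with h
  · exact List.count_filter h
  · exact List.count_eq_zero_of_not_mem fun hx => h (List.mem_filter.1 hx).2

theorem count_twoUniformCompletion {w : List ℕ} {x : ℕ} (hx : x ∈ twoUniformCompletion w) :
    (twoUniformCompletion w).count x = 2 := by
  obtain ⟨hx, h2⟩ := mem_twoUniformCompletion.1 hx
  have := List.count_pos_iff.2 hx
  rw [twoUniformCompletion, List.count_append, count_filter_ite, count_filter_ite]
  simp only [decide_eq_true_eq]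
  split_ifs <;> omega

theorem isChain_append_iff_of_count {l : List ℕ} {x y : ℕ} (hxy : x ≠ y)
    (hl : ∀ c ∈ l, c = x ∨ c = y) (hx : l.count x = 1) (hy : l.count y = 2) :
    (l ++ [x]).IsChain (· ≠ ·) ↔ l.IsChain (· ≠ ·) := by
  have hlen := length_eq_count_add_count hxy hl
  rw [hx, hy] at hlen
  obtain ⟨a, b, c, rfl⟩ := List.length_eq_three.1 hlen
  have ha := hl a (by simp)
  have hb := hl b (by simp)
  have hc := hl c (by simp)
  rcases ha with rfl | rfl <;> rcases hb with rfl | rfl <;> rcases hc with rfl | rfl <;>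
    simp_all [List.count_cons]

theorem alternate_twoUniformCompletion {w : List ℕ} {x y : ℕ} (hxy : x ≠ y)
    (hx : x ∈ twoUniformCompletion w) (hy : y ∈ twoUniformCompletion w) :
    Alternate (twoUniformCompletion w) x y ↔ Alternate w x y := by
  obtain ⟨hxw, hx2⟩ := mem_twoUniformCompletion.1 hx
  obtain ⟨hyw, hy2⟩ := mem_twoUniformCompletion.1 hy
  have hx1 := List.count_pos_iff.2 hxw
  have hy1 := List.count_pos_iff.2 hyw
  wlog hle : w.count x ≤ w.count y generalizing x y
  · rw [alternate_comm, alternate_comm (w := w)]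
    exact this hxy.symm hy hx hyw hy2 hxw hx2 hy1 hx1 (by omega)
  set p : ℕ → Bool := fun c => decide (c = x ∨ c = y) with hp
  have hmem : ∀ c ∈ w.filter p, c = x ∨ c = y := fun c hc => by
    simpa [hp] using (List.mem_filter.1 hc).2
  have hcx : (w.filter p).count x = w.count x := List.count_filter (by simp [hp])
  have hcy : (w.filter p).count y = w.count y := List.count_filter (by simp [hp])
  have hfirst : (w.filter (fun c => decide (w.count c ≤ 2))).filter p = w.filter p := by
    rw [List.filter_filter]
    refine List.filter_congr fun c _ => ?_
    by_cases h : c = x ∨ c = y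
    · rcases h with rfl | rfl <;> simp [hx2, hy2, hp]
    · simp [hp, h]
  have hsecond : (w.filter (fun c => decide (w.count c = 1))).filter p =
      (w.filter p).filter (fun c => decide (w.count c = 1)) := List.filter_comm _ _ _
  change ((twoUniformCompletion w).filter p).IsChain (· ≠ ·) ↔ (w.filter p).IsChain (· ≠ ·)
  rw [twoUniformCompletion, List.filter_append, hfirst, hsecond]
  rcases (by omega : w.count x = 2 ∧ w.count y = 2 ∨ w.count x = 1 ∧ w.count y = 2 ∨
    w.count x = 1 ∧ w.count y = 1) with h | h | h
  · have : (w.filter p).filter (fun c => decide (w.count c = 1)) = [] := by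
      rw [List.filter_eq_nil_iff]
      intro c hc
      rcases hmem c hc with rfl | rfl <;> simp [h]
    rw [this, List.append_nil]
  · have : (w.filter p).filter (fun c => decide (w.count c = 1)) = [x] := by
      have h' : (w.filter p).filter (fun c => decide (w.count c = 1)) =
          (w.filter p).filter (· == x) := by
        refine List.filter_congr fun c hc => ?_
        rcases hmem c hc with rfl | rfl <;> simp [h, hxy.symm]
      rw [h', List.filter_beq, hcx, h.1]
      rfl
    rw [this]
    exact isChain_append_iff_of_count hxy hmem (hcx.trans h.1) (hcy.trans h.2)
  · have : (w.filter p).filter (fun c => decide (w.count c = 1)) = w.filter p := by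
      rw [List.filter_eq_self]
      intro c hc
      rcases hmem c hc with rfl | rfl <;> simp [h]
    rw [this]
    have hlen := length_eq_count_add_count hxy hmem
    rw [hcx, hcy, h.1, h.2] at hlen
    clear hfirst hsecond this hcx hcy
    generalize w.filter p = l at *
    have hyx := hxy.symm
    obtain ⟨a, b, rfl⟩ := List.length_eq_two.1 hlen
    have ha := hmem a (by simp)
    have hb := hmem b (by simp)
    rcases ha with rfl | rfl <;> rcases hb with rfl | rfl <;> simp [hxy, hyx]

/-- The subgraph of `H` induced by `S` is represented by a 2-uniform word. -/
def IsCircleOn (H : SimpleGraph ℕ) (S : Finset ℕ) : Prop :=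
  ∃ w : List ℕ, w.toFinset = S ∧ (∀ x ∈ w, w.count x = 2) ∧
    ∀ x y, x ≠ y → x ∈ w → y ∈ w → (H.Adj x y ↔ Alternate w x y)

/-- Being a circle graph is preserved by adding the vertex `x`, if the representing word
extends to one that alternates correctly between `x` and the old letters. -/
theorem isCircleOn_insert_of_word {H : SimpleGraph ℕ} {w a b c : List ℕ} {x : ℕ}
    (hw : w = a ++ b ++ c) (hxw : x ∉ w) (hcount : ∀ z ∈ w, w.count z = 2)
    (hrep : ∀ u v, u ≠ v → u ∈ w → v ∈ w → (H.Adj u v ↔ Alternate w u v))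
    (hx : ∀ z ∈ w, H.Adj x z ↔ Alternate (a ++ x :: b ++ x :: c) x z) :
    IsCircleOn H (insert x w.toFinset) := by
  have hmem : ∀ z, z ∈ a ++ x :: b ++ x :: c ↔ z = x ∨ z ∈ w := by
    intro z; simp [hw]; tauto
  refine ⟨a ++ x :: b ++ x :: c, ?_, ?_, ?_⟩
  · ext z
    rw [List.mem_toFinset, hmem]
    simp
  · intro z hz
    by_cases hzx : z = x
    · subst hzx
      have := List.count_eq_zero_of_not_mem hxw
      simp only [hw, List.count_append] at this
      simp only [List.count_append, List.count_cons_self]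
      omega
    · have := hcount z (((hmem z).1 hz).resolve_left hzx)
      simp only [hw, List.count_append] at this
      simp only [List.count_append, List.count_cons_of_ne (Ne.symm hzx)]
      omega
  · intro u v huv hu hv
    rcases (hmem u).1 hu with rfl | huw
    · exact hx v (((hmem v).1 hv).resolve_left huv.symm)
    · rcases (hmem v).1 hv with rfl | hvw
      · rw [H.adj_comm, alternate_comm]
        exact hx u huw
      · rw [hrep u v huv huw hvw]
        have hux : x ≠ u := fun h => hxw (h ▸ huw)
        have hvx : x ≠ v := fun h => hxw (h ▸ hvw)
        simp [Alternate, hw, List.filter_append, hux, hvx]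

/-- Being a circle graph is preserved by adding a vertex of degree at most one. -/
theorem IsCircleOn.insert {H : SimpleGraph ℕ} {S : Finset ℕ} (hS : IsCircleOn H S) {x : ℕ}
    (hxS : x ∉ S) (hx : ∀ y ∈ S, ∀ z ∈ S, H.Adj x y → H.Adj x z → y = z) :
    IsCircleOn H (insert x S) := by
  obtain ⟨w, rfl, hcount, hrep⟩ := hS
  simp only [List.mem_toFinset] at hxS hx
  by_cases hy : ∃ y ∈ w, H.Adj x y
  · obtain ⟨y, hyw, hxy⟩ := hy
    obtain ⟨a, b, rfl, hya⟩ := List.eq_append_cons_of_mem hyw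
    refine isCircleOn_insert_of_word (a := a) (b := [y]) (c := b) (by simp) hxS hcount hrep ?_
    intro z hz
    have hxa : x ∉ a := fun h => hxS (by simp [h])
    have hxb : x ∉ b := fun h => hxS (by simp [h])
    by_cases hzy : z = y
    · subst hzy
      refine iff_of_true hxy ?_
      have hfa : a.filter (fun c => decide (c = x ∨ c = z)) = [] := by
        rw [List.filter_eq_nil_iff]
        intro c hc
        have h1 : c ≠ x := fun e => hxa (e ▸ hc)
        have h2 : c ≠ z := fun e => hya (e ▸ hc)
        simp [h1, h2]
      have hfb : b.filter (fun c => decide (c = x ∨ c = z)) = [z] := by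
        have h : b.filter (fun c => decide (c = x ∨ c = z)) = b.filter (· == z) := by
          refine List.filter_congr fun c hc => ?_
          have h1 : c ≠ x := fun e => hxb (e ▸ hc)
          simp only [h1, false_or, beq_eq_decide]
        have hz2 := hcount z hyw
        rw [List.count_append, List.count_cons_self, List.count_eq_zero_of_not_mem hya] at hz2
        rw [h, List.filter_beq, show b.count z = 1 by omega]
        rfl
      have hne := hxy.ne
      simp only [Bool.decide_or] at hfa hfb
      simp [Alternate, List.Chain', List.filter_append, hfa, hfb, hne, hne.symm]
    · refine iff_of_false (fun h => hzy (hx z hz y hyw h hxy)) fun h => hzy ?_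
      simpa using Alternate.mem_between h
  · push Not at hy
    refine isCircleOn_insert_of_word (a := []) (b := []) (c := w) (by simp) hxS hcount hrep ?_
    intro z hz
    refine iff_of_false (hy z hz) fun h => ?_
    simpa using Alternate.mem_between h

/-- Every 132-representable finite simple graph is a circle graph: some graph
isomorphic to it is represented by a 2-uniform word. -/
theorem circle_of_representable132 {V : Type*} [Fintype V] (G : SimpleGraph V)
    (h : Representable132 G) :
    ∃ (w : List ℕ) (H : SimpleGraph ℕ),
      (∀ x ∈ w, w.count x = 2) ∧ Represents w H ∧
      Nonempty (G ≃g H.induce (↑w.toFinset : Set ℕ)) := by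
  obtain ⟨w, H, hav, ⟨hmem, hrep⟩, hiso⟩ := h
  have base : IsCircleOn H (twoUniformCompletion w).toFinset :=
    ⟨_, rfl, fun x hx => count_twoUniformCompletion hx, fun x y hxy hx hy => by
      rw [alternate_twoUniformCompletion hxy hx hy]
      exact hrep x y hxy (mem_twoUniformCompletion.1 hx).1 (mem_twoUniformCompletion.1 hy).1⟩
  have step : ∀ T : Finset ℕ, (∀ x ∈ T, x ∈ w ∧ 3 ≤ w.count x) →
      IsCircleOn H (T ∪ (twoUniformCompletion w).toFinset) := by
    intro T
    induction T using Finset.induction_on with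
    | empty => intro _; simpa using base
    | insert x T hxT ih =>
      intro hT
      obtain ⟨hxw, hx3⟩ := hT x (Finset.mem_insert_self x T)
      rw [Finset.insert_union]
      refine (ih fun y hy => hT y (Finset.mem_insert_of_mem hy)).insert ?_ ?_
      · rw [Finset.mem_union, List.mem_toFinset, mem_twoUniformCompletion]
        rintro (h | h)
        · exact hxT h
        · omega
      · intro y _ z _ hy hz
        exact hav.eq_of_alternate hx3 hy.ne' hz.ne'
          ((hrep x y hy.ne hxw (hmem y x hy.symm)).1 hy)
          ((hrep x z hz.ne hxw (hmem z x hz.symm)).1 hz)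
  obtain ⟨w', hw', hcount, hrep'⟩ := step (w.toFinset.filter fun x => 3 ≤ w.count x) (by simp)
  have hletters : w'.toFinset = w.toFinset := by
    rw [hw']
    ext x
    simp only [Finset.mem_union, Finset.mem_filter, List.mem_toFinset, mem_twoUniformCompletion]
    constructor
    · rintro (h | h) <;> exact h.1
    · intro h
      rcases le_or_gt (w.count x) 2 with h2 | h2
      · exact Or.inr ⟨h, h2⟩
      · exact Or.inl ⟨h, h2⟩
  refine ⟨w', H, hcount, ⟨fun x y hxy => ?_, hrep'⟩, ?_⟩
  · rw [← List.mem_toFinset, hletters, List.mem_toFinset]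
    exact hmem x y hxy
  · rw [hletters]
    exact hiso
end

section
/- For every n ≥ 3, the cycle graph C_n is 132-representable. -/
/-- The cycle graph `C n` on vertex set `{1, …, n}`, whose edges are exactly the
pairs `{i, i+1}` for `1 ≤ i ≤ n - 1` together with `{1, n}` (all other vertices
of `ℕ` are isolated). -/
def cycleGraphOn (n : ℕ) : SimpleGraph ℕ :=
  SimpleGraph.fromRel
    (fun x y => (1 ≤ x ∧ x ≤ n - 1 ∧ y = x + 1) ∨ (x = 1 ∧ y = n))

/-- The word `k (k+1) (k-1) k ⋯ 1 2 n 1`. -/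
def descendingPairs (n : ℕ) : ℕ → List ℕ
  | 0 => [n, 1]
  | k + 1 => (k + 1) :: (k + 2) :: descendingPairs n k

theorem mem_descendingPairs {n k x : ℕ} :
    x ∈ descendingPairs n k ↔ x = n ∨ (1 ≤ x ∧ x ≤ k + 1) := by
  induction k with
  | zero =>
    simp only [descendingPairs, List.mem_cons, List.not_mem_nil, or_false]
    omega
  | succ k ih =>
    simp only [descendingPairs, List.mem_cons, ih]
    omega

theorem Avoids132.cons {a : ℕ} {l : List ℕ} (hl : Avoids132 l)
    (ha : l.Pairwise fun b c => ¬(a < c ∧ c < b)) : Avoids132 (a :: l) := by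
  intro i j k hij hjk
  induction j using Fin.cases with
  | zero => exact absurd hij (Fin.not_lt_zero i)
  | succ j =>
    induction k using Fin.cases with
    | zero => exact absurd hjk (Fin.not_lt_zero _)
    | succ k =>
      have hjk' : j < k := Fin.succ_lt_succ_iff.mp hjk
      induction i using Fin.cases with
      | zero => exact List.pairwise_iff_get.mp ha j k hjk'
      | succ i => exact hl i j k (Fin.succ_lt_succ_iff.mp hij) hjk'

theorem avoids132_descendingPairs {n k : ℕ} (hk : k < n) :
    Avoids132 (descendingPairs n k) := by
  induction k with
  | zero =>
    have hnil : Avoids132 [] := fun i => i.elim0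
    exact (hnil.cons List.Pairwise.nil).cons (List.pairwise_singleton _ _)
  | succ k ih =>
    have key : ∀ a, k + 1 ≤ a →
        (descendingPairs n k).Pairwise fun b c => ¬(a < c ∧ c < b) := by
      intro a ha
      refine List.pairwise_of_forall_mem_list ?_
      intro b hb c hc
      rw [mem_descendingPairs] at hb hc
      omega
    refine ((ih (by omega)).cons (key _ (by omega))).cons ?_
    refine List.pairwise_cons.mpr ⟨?_, key _ le_rfl⟩
    intro c _
    omega

/-- The restriction of a word to the letters `x` and `y`. -/
abbrev restrictPair (x y : ℕ) (w : List ℕ) : List ℕ :=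
  w.filter (fun c => decide (c = x ∨ c = y))

theorem restrictPair_succ (x y n k : ℕ) :
    restrictPair x y (descendingPairs n (k + 1)) =
      (if k + 1 = x ∨ k + 1 = y then [k + 1] else []) ++
      (if k + 2 = x ∨ k + 2 = y then [k + 2] else []) ++
      restrictPair x y (descendingPairs n k) := by
  simp only [restrictPair, descendingPairs, List.filter_cons, decide_eq_true_eq]
  split_ifs <;> simp

section
variable {n x y k : ℕ}

theorem restrictPair_of_lt (hxy : x < y) (hyn : y < n) (hk : k + 1 < x) :
    restrictPair x y (descendingPairs n k) = [] := by
  rw [List.filter_eq_nil_iff]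
  intro a ha
  rw [mem_descendingPairs] at ha
  simp only [decide_eq_true_eq]
  omega

theorem restrictPair_pred (hx : k + 1 = x) (hxy : x < y) (hyn : y < n) :
    restrictPair x y (descendingPairs n k) = [x] := by
  cases k with
  | zero =>
    subst hx
    simp [restrictPair, descendingPairs, List.filter_cons]
    omega
  | succ k =>
    rw [restrictPair_succ, restrictPair_of_lt hxy hyn (by omega), if_neg (by omega),
      if_pos (by omega)]
    simp [← hx]

theorem restrictPair_consecutive (hx : 1 ≤ x) (hy : y = x + 1) (hyn : y < n)
    (hk : y ≤ k) : restrictPair x y (descendingPairs n k) = [y, x, y, x] := by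
  induction k, hk using Nat.le_induction with
  | base =>
    obtain ⟨j, rfl⟩ : ∃ j, x = j + 1 := ⟨x - 1, by omega⟩
    subst hy
    rw [restrictPair_succ, restrictPair_succ, restrictPair_pred rfl (by omega) hyn]
    simp
  | succ k hk ih =>
    rw [restrictPair_succ, ih, if_neg (by omega), if_neg (by omega)]
    rfl

theorem restrictPair_between (hx : 1 ≤ x) (hxk : x ≤ k) (hky : k + 1 < y) (hyn : y < n) :
    restrictPair x y (descendingPairs n k) = [x, x] := by
  induction k, hxk using Nat.le_induction with
  | base =>
    obtain ⟨j, rfl⟩ : ∃ j, x = j + 1 := ⟨x - 1, by omega⟩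
    rw [restrictPair_succ, restrictPair_pred rfl (by omega) hyn, if_pos (by omega),
      if_neg (by omega)]
    rfl
  | succ k hk ih =>
    rw [restrictPair_succ, ih (by omega), if_neg (by omega), if_neg (by omega)]
    rfl

theorem restrictPair_nonconsecutive (hx : 1 ≤ x) (hxy : x + 1 < y) (hyn : y < n)
    (hk : y ≤ k) : restrictPair x y (descendingPairs n k) = [y, y, x, x] := by
  induction k, hk using Nat.le_induction with
  | base =>
    obtain ⟨j, rfl⟩ : ∃ j, y = j + 2 := ⟨y - 2, by omega⟩
    rw [restrictPair_succ, restrictPair_succ, restrictPair_between hx (by omega) (by omega) hyn,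
      if_pos (by omega), if_neg (by omega), if_neg (by omega)]
    rfl
  | succ k hk ih =>
    rw [restrictPair_succ, ih, if_neg (by omega), if_neg (by omega)]
    rfl

theorem restrictPair_last_of_lt (hxn : x < n) (hk : k + 1 < x) :
    restrictPair x n (descendingPairs n k) = [n] := by
  induction k with
  | zero =>
    simp [restrictPair, descendingPairs, List.filter_cons]
    omega
  | succ k ih =>
    rw [restrictPair_succ, ih (by omega), if_neg (by omega), if_neg (by omega)]
    rfl

theorem restrictPair_last_pred (hx : 1 < x) (hk : k + 1 = x) (hxn : x < n) :
    restrictPair x n (descendingPairs n k) = [x, n] := by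
  obtain ⟨j, rfl⟩ : ∃ j, k = j + 1 := ⟨k - 1, by omega⟩
  rw [restrictPair_succ, restrictPair_last_of_lt hxn (by omega), if_neg (by omega),
    if_pos (by omega)]
  simp [← hk]

theorem restrictPair_last (hx : 1 < x) (hxk : x ≤ k) (hkn : k + 1 < n) :
    restrictPair x n (descendingPairs n k) = [x, x, n] := by
  induction k, hxk using Nat.le_induction with
  | base =>
    obtain ⟨j, rfl⟩ : ∃ j, x = j + 1 := ⟨x - 1, by omega⟩
    rw [restrictPair_succ, restrictPair_last_pred hx rfl (by omega), if_pos (by omega),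
      if_neg (by omega)]
    rfl
  | succ k hk ih =>
    rw [restrictPair_succ, ih (by omega), if_neg (by omega), if_neg (by omega)]
    rfl

theorem restrictPair_last_one (hk : 1 ≤ k) (hkn : k + 1 < n) :
    restrictPair 1 n (descendingPairs n k) = [1, n, 1] := by
  induction k, hk using Nat.le_induction with
  | base =>
    rw [restrictPair_succ, if_pos (by omega), if_neg (by omega)]
    simp [restrictPair, descendingPairs]
  | succ k hk ih =>
    rw [restrictPair_succ, ih (by omega), if_neg (by omega), if_neg (by omega)]
    rfl

end

theorem alternate_descendingPairs {n x y : ℕ} (hn : 3 ≤ n) (hx : 1 ≤ x) (hxy : x < y)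
    (hy : y ≤ n) :
    Alternate (descendingPairs n (n - 1)) x y ↔ y = x + 1 ∨ (x = 1 ∧ y = n) := by
  change (restrictPair x y _).IsChain _ ↔ _
  rcases hy.lt_or_eq with hyn | rfl
  · rcases (Nat.succ_le_of_lt hxy).lt_or_eq with h | h
    · rw [restrictPair_nonconsecutive hx h hyn (by omega)]
      simp
      omega
    · rw [restrictPair_consecutive hx h.symm hyn (by omega)]
      simp
      omega
  · obtain ⟨m, rfl⟩ : ∃ m, y = m + 2 := ⟨y - 2, by omega⟩
    change (restrictPair x _ (descendingPairs _ (m + 1))).IsChain _ ↔ _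
    rw [restrictPair_succ]
    by_cases h : m + 1 = x
    · rw [restrictPair_last_pred (by omega) h hxy, if_pos (by omega), if_pos (by omega)]
      simp
      omega
    · rw [if_neg (by omega), if_pos (by omega)]
      by_cases h1 : x = 1
      · subst h1
        rw [restrictPair_last_one (by omega) (by omega)]
        simp
      · rw [restrictPair_last (by omega) (by omega) (by omega)]
        simp
        omega

theorem cycleGraphOn_adj_of_lt {n x y : ℕ} (hn : 3 ≤ n) (hx : 1 ≤ x) (hxy : x < y)
    (hy : y ≤ n) : (cycleGraphOn n).Adj x y ↔ y = x + 1 ∨ (x = 1 ∧ y = n) := by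
  simp only [cycleGraphOn, SimpleGraph.fromRel_adj]
  omega

theorem represents_descendingPairs {n : ℕ} (hn : 3 ≤ n) :
    Represents (descendingPairs n (n - 1)) (cycleGraphOn n) := by
  refine ⟨?_, ?_⟩
  · intro x y h
    simp only [cycleGraphOn, SimpleGraph.fromRel_adj] at h
    rw [mem_descendingPairs]
    omega
  · intro x y hxy hx hy
    rw [mem_descendingPairs] at hx hy
    rcases hxy.lt_or_gt with h | h
    · rw [cycleGraphOn_adj_of_lt hn (by omega) h (by omega),
        alternate_descendingPairs hn (by omega) h (by omega)]
    · rw [SimpleGraph.adj_comm, alternate_comm,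
        cycleGraphOn_adj_of_lt hn (by omega) h (by omega),
        alternate_descendingPairs hn (by omega) h (by omega)]

/-- For every `n ≥ 3`, the cycle graph `C n` is 132-representable. -/
theorem cycle_representable132 (n : ℕ) (hn : 3 ≤ n) :
    Representable132 ((cycleGraphOn n).induce (↑(Finset.Icc 1 n) : Set ℕ)) := by
  refine ⟨descendingPairs n (n - 1), cycleGraphOn n, avoids132_descendingPairs (by omega),
    represents_descendingPairs hn, ?_⟩
  have hletters : (descendingPairs n (n - 1)).toFinset = Finset.Icc 1 n := by
    ext x
    rw [List.mem_toFinset, mem_descendingPairs, Finset.mem_Icc]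
    omega
  rw [hletters]
  exact ⟨SimpleGraph.Iso.refl⟩
end

section
/- For n ≥ 3, the number of 132-avoiding words w with A(w) = {1, 2, …, n} that represent the complete graph K_n on vertex set {1, 2, …, n} equals 2 + C_{n−2} + Σ_{i=0}^{n} C_i, where C_m denotes the m-th Catalan number C_m = (1/(m+1))·binomial(2m, m). -/
/-- The complete graph `K n` on vertex set `{1, …, n}`: two distinct vertices are
adjacent iff both lie in `{1, …, n}` (all other vertices of `ℕ` are isolated). -/
def completeOn (n : ℕ) : SimpleGraph ℕ :=
  SimpleGraph.fromRel (fun x y => 1 ≤ x ∧ x ≤ n ∧ 1 ≤ y ∧ y ≤ n)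

/-- `Avoids132`, phrased through `List.Triplewise`. -/
abbrev TriplewiseAvoids (w : List ℕ) : Prop :=
  w.Triplewise fun a b c => ¬(a < c ∧ c < b)

theorem avoids132_iff_triplewiseAvoids (w : List ℕ) : Avoids132 w ↔ TriplewiseAvoids w := by
  rw [TriplewiseAvoids, List.triplewise_iff_getElem]
  constructor
  · intro h i j k hij hjk hk
    exact h ⟨i, by omega⟩ ⟨j, by omega⟩ ⟨k, hk⟩ hij hjk
  · intro h i j k hij hjk
    exact h i j k hij hjk k.2

theorem eq_range'_of_perm {l : List ℕ} {a m : ℕ} (h : l.Perm (List.range' a m))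
    (hs : l.Pairwise (· ≤ ·)) : l = List.range' a m :=
  h.eq_of_pairwise' hs (List.pairwise_le_range' (s := a) (n := m))

theorem perm_range'_of_append {A B : List ℕ} {a m : ℕ}
    (h : (A ++ B).Perm (List.range' a m)) (hAB : ∀ x ∈ A, ∀ y ∈ B, y ≤ x) :
    A.Perm (List.range' (a + B.length) A.length) ∧ B.Perm (List.range' a B.length) := by
  have hA := A.perm_insertionSort (· ≤ ·)
  have hB := B.perm_insertionSort (· ≤ ·)
  have hm : m = B.length + A.length := by
    have := h.length_eq
    simp at this
    omega
  have key : B.insertionSort (· ≤ ·) ++ A.insertionSort (· ≤ ·) = List.range' a m := by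
    apply eq_range'_of_perm
    · exact ((hB.append hA).trans List.perm_append_comm).trans h
    · rw [List.pairwise_append]
      refine ⟨List.pairwise_insertionSort _ _, List.pairwise_insertionSort _ _, ?_⟩
      intro x hx y hy
      exact hAB y (hA.mem_iff.1 hy) x (hB.mem_iff.1 hx)
  rw [hm, ← List.range'_append_1] at key
  obtain ⟨h1, h2⟩ := List.append_inj key (by simp [hB.length_eq])
  exact ⟨h2 ▸ hA.symm, h1 ▸ hB.symm⟩

/-- The 132-avoiding arrangement of `a, a + 1, …` encoded by a binary tree: the root is the
maximum, and the left subtree holds the larger ones of the other letters. -/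
def wordOfTree (a : ℕ) : BinaryTree Unit → List ℕ
  | .nil => []
  | .node _ l r => wordOfTree (a + r.numNodes) l ++
      (a + (l.numNodes + r.numNodes)) :: wordOfTree a r

theorem wordOfTree_perm (a : ℕ) (t : BinaryTree Unit) :
    (wordOfTree a t).Perm (List.range' a t.numNodes) := by
  induction t generalizing a with
  | nil => exact List.Perm.refl _
  | node u l r ihl ihr =>
    have e : List.range' a (BinaryTree.node u l r).numNodes =
        (List.range' a r.numNodes ++ List.range' (a + r.numNodes) l.numNodes) ++
          [a + (l.numNodes + r.numNodes)] := by
      rw [List.range'_append_1, BinaryTree.numNodes, List.range'_1_concat]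
      simp [Nat.add_comm]
    rw [e, wordOfTree]
    refine List.perm_middle.trans ?_
    refine List.Perm.trans ?_ (List.perm_append_singleton _ _).symm
    refine List.Perm.cons _ ?_
    exact ((ihl _).append (ihr _)).trans List.perm_append_comm

theorem length_wordOfTree (a : ℕ) (t : BinaryTree Unit) :
    (wordOfTree a t).length = t.numNodes := by
  simpa using (wordOfTree_perm a t).length_eq

theorem mem_wordOfTree {a x : ℕ} {t : BinaryTree Unit} :
    x ∈ wordOfTree a t ↔ a ≤ x ∧ x < a + t.numNodes := by
  rw [(wordOfTree_perm a t).mem_iff, List.mem_range'_1]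

theorem triplewiseAvoids_wordOfTree (a : ℕ) (t : BinaryTree Unit) :
    TriplewiseAvoids (wordOfTree a t) := by
  induction t generalizing a with
  | nil => exact .nil
  | node u l r ihl ihr =>
    have hl : ∀ x ∈ wordOfTree (a + r.numNodes) l,
        a + r.numNodes ≤ x ∧ x < a + r.numNodes + l.numNodes := fun x hx => mem_wordOfTree.1 hx
    have hr : ∀ x ∈ wordOfTree a r, a ≤ x ∧ x < a + r.numNodes := fun x hx => mem_wordOfTree.1 hx
    simp only [wordOfTree, TriplewiseAvoids, List.triplewise_append, List.triplewise_cons,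
      List.pairwise_cons, List.mem_cons]
    refine ⟨ihl _, ⟨?_, ihr _⟩, ?_, ?_⟩
    · exact List.pairwise_of_forall_mem_list fun x hx y hy => by grind
    · intro x hx
      refine ⟨fun y hy => by grind, ?_⟩
      exact List.pairwise_of_forall_mem_list fun y hy z hz => by grind
    · intro x hx
      exact List.pairwise_of_forall_mem_list fun y hy z hz => by grind

theorem wordOfTree_injective (a : ℕ) : Function.Injective (wordOfTree a) := by
  intro t
  induction t generalizing a with
  | nil =>
    intro t' h
    cases t' with
    | nil => rfl
    | node u l r => simp [wordOfTree] at h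
  | node u l r ihl ihr =>
    intro t' h
    cases t' with
    | nil => simp [wordOfTree] at h
    | node u' l' r' =>
      have hlen : l.numNodes + r.numNodes = l'.numNodes + r'.numNodes := by
        have := congrArg List.length h
        rw [length_wordOfTree, length_wordOfTree] at this
        simpa [BinaryTree.numNodes] using this
      simp only [wordOfTree] at h
      rw [hlen] at h
      obtain ⟨h1, -, h2⟩ := (List.append_cons_inj_of_notMem
        (fun hm => by rw [mem_wordOfTree] at hm; omega)
        (fun hm => by rw [mem_wordOfTree] at hm; omega)).1 h
      obtain rfl := ihr _ h2
      obtain rfl := ihl _ h1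
      rfl

theorem exists_wordOfTree_eq {w : List ℕ} {a m : ℕ} (hw : w.Perm (List.range' a m))
    (hav : TriplewiseAvoids w) : ∃ t, t.numNodes = m ∧ wordOfTree a t = w := by
  induction m using Nat.strong_induction_on generalizing w a with
  | _ m ih =>
    cases m with
    | zero => exact ⟨.nil, rfl, by simpa [wordOfTree] using hw.symm⟩
    | succ m =>
      have hM : a + m ∈ w := hw.mem_iff.2 (by simp [List.mem_range'_1])
      obtain ⟨A, B, rfl⟩ := List.append_of_mem hM
      have hAB : (A ++ B).Perm (List.range' a m) := by
        rw [List.range'_1_concat] at hw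
        exact (List.perm_middle.symm.trans
          (hw.trans (List.perm_append_singleton _ _))).cons_inv
      have hlt : ∀ x ∈ A ++ B, x < a + m := fun x hx =>
        (List.mem_range'_1.1 (hAB.mem_iff.1 hx)).2
      simp only [TriplewiseAvoids, List.triplewise_append, List.triplewise_cons,
        List.pairwise_cons] at hav
      obtain ⟨hA, ⟨-, hB⟩, h1, -⟩ := hav
      obtain ⟨pA, pB⟩ := perm_range'_of_append hAB fun x hx y hy => by
        have := (h1 x hx).1 y hy
        have := hlt y (by simp [hy])
        omega
      have hlen : A.length + B.length = m := by simpa using hAB.length_eq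
      obtain ⟨l, hl, rfl⟩ := ih A.length (by omega) pA hA
      obtain ⟨r, hr, rfl⟩ := ih B.length (by omega) pB hB
      refine ⟨.node () l r, by simp only [BinaryTree.numNodes]; omega, ?_⟩
      simp only [wordOfTree, hr]
      congr 3
      omega

/-- The 132-avoiding permutations of `1, …, m`, as words. -/
def avoidingPerms (m : ℕ) : Finset (List ℕ) :=
  (BinaryTree.treesOfNumNodesEq m).image (wordOfTree 1)

theorem mem_avoidingPerms {m : ℕ} {w : List ℕ} :
    w ∈ avoidingPerms m ↔ w.Perm (List.range' 1 m) ∧ TriplewiseAvoids w := by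
  simp only [avoidingPerms, Finset.mem_image, BinaryTree.mem_treesOfNumNodesEq]
  constructor
  · rintro ⟨t, rfl, rfl⟩
    exact ⟨wordOfTree_perm 1 t, triplewiseAvoids_wordOfTree 1 t⟩
  · rintro ⟨hp, hav⟩
    exact exists_wordOfTree_eq hp hav

theorem card_avoidingPerms (m : ℕ) : (avoidingPerms m).card = catalan m := by
  rw [avoidingPerms, Finset.card_image_of_injective _ (wordOfTree_injective 1),
    BinaryTree.treesOfNumNodesEq_card_eq_catalan]

theorem alternate_iff {w : List ℕ} {x y : ℕ} : Alternate w x y ↔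
    (w.filter (fun c => decide (c = x ∨ c = y))).IsChain (· ≠ ·) :=
  Iff.rfl

theorem mem_of_alternate {A B C : List ℕ} {x y : ℕ}
    (h : Alternate (A ++ x :: (B ++ x :: C)) x y) : y ∈ B := by
  by_contra hy
  rw [alternate_iff] at h
  have hB : B.filter (fun c => decide (c = x ∨ c = y)) =
      List.replicate (B.filter (fun c => decide (c = x ∨ c = y))).length x := by
    rw [List.eq_replicate_iff]
    refine ⟨rfl, fun b hb => ?_⟩
    rw [List.mem_filter, decide_eq_true_eq] at hb
    exact hb.2.resolve_right fun e => hy (e ▸ hb.1)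
  rw [List.filter_append, List.filter_cons_of_pos (by simp), List.filter_append,
    List.filter_cons_of_pos (by simp), hB] at h
  have h' := h.right_of_append
  revert h'
  generalize (B.filter (fun c => decide (c = x ∨ c = y))).length = k
  cases k <;> simp [List.replicate_succ]

/-- Any two distinct letters of `s` alternate in `w`. -/
def AlternatesOn (s : Set ℕ) (w : List ℕ) : Prop :=
  ∀ x ∈ s, ∀ y ∈ s, x ≠ y → Alternate w x y

theorem AlternatesOn.tail {s : Set ℕ} {a : ℕ} {w : List ℕ} (h : AlternatesOn s (a :: w)) :
    AlternatesOn s w := by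
  intro x hx y hy hxy
  have h' := h x hx y hy hxy
  rw [alternate_iff] at h' ⊢
  rw [List.filter_cons] at h'
  split at h'
  · exact h'.tail
  · exact h'

theorem AlternatesOn.exists_eq_cons {s : Set ℕ} {P Q : List ℕ} {q : ℕ}
    (h : AlternatesOn s (P ++ q :: Q)) (hP : P.Nodup) (hq : q ∈ P) (hs : ∀ x ∈ P, x ∈ s) :
    ∃ B, P = q :: B ∧ ∀ y ∈ s, y ∈ P := by
  obtain ⟨A, B, rfl⟩ := List.append_of_mem hq
  have key : ∀ y ∈ s, y ≠ q → y ∈ B := fun y hy hyq =>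
    mem_of_alternate (A := A) (C := Q) (x := q) (by
      simpa using h q (hs q hq) y hy hyq.symm)
  cases A with
  | nil =>
    refine ⟨B, rfl, fun y hy => ?_⟩
    by_cases e : y = q
    · simp [e]
    · simp [key y hy e]
  | cons c A =>
    have hc : c ∈ s := hs c (by simp)
    have := key c hc
    simp at hP
    grind

theorem alternate_append_prefix {P Q : List ℕ} {x y : ℕ} (hP : P.Nodup) (hQ : Q <+: P)
    (hx : x ∈ P) (hy : y ∈ P) (hxy : x ≠ y) : Alternate (P ++ Q) x y := by
  rw [alternate_iff]
  rw [List.filter_append]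
  have hF := hQ.filter (fun c => decide (c = x ∨ c = y))
  have hperm : (P.filter (fun c => decide (c = x ∨ c = y))).Perm [x, y] := by
    rw [List.perm_ext_iff_of_nodup (hP.filter _) (by simp [hxy])]
    intro c
    simp only [List.mem_filter, decide_eq_true_eq, List.mem_cons, List.not_mem_nil, or_false]
    constructor
    · exact fun h => h.2
    · rintro (rfl | rfl) <;> simp [*]
  have main : ∀ u v : ℕ, u ≠ v → ∀ l, l <+: [u, v] → ([u, v] ++ l).IsChain (· ≠ ·) := by
    intro u v huv l hl
    rw [List.prefix_cons_iff] at hl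
    rcases hl with rfl | ⟨t, rfl, ht⟩
    · simp [huv]
    · rw [List.prefix_cons_iff] at ht
      rcases ht with rfl | ⟨t, rfl, ht⟩
      · simp [huv, huv.symm]
      · obtain rfl := List.prefix_nil.1 ht
        simp [huv, huv.symm]
  rcases List.perm_pair.1 hperm with e | e
  · rw [e] at hF ⊢
    exact main x y hxy _ hF
  · rw [e] at hF ⊢
    exact main y x hxy.symm _ hF

theorem exists_maximal_nodup_prefix (w : List ℕ) :
    ∃ P Q : List ℕ, w = P ++ Q ∧ P.Nodup ∧ (Q = [] ∨ ∃ q R, Q = q :: R ∧ q ∈ P) := by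
  induction w using List.reverseRecOn with
  | nil => exact ⟨[], [], rfl, List.nodup_nil, .inl rfl⟩
  | append_singleton w a ih =>
    obtain ⟨P, Q, rfl, hP, rfl | ⟨q, R, rfl, hq⟩⟩ := ih
    · by_cases ha : a ∈ P
      · exact ⟨P, [a], by simp, hP, .inr ⟨a, [], rfl, ha⟩⟩
      · exact ⟨P ++ [a], [], by simp,
          by simpa [List.nodup_append, hP] using fun b hb (e : b = a) => ha (e ▸ hb), .inl rfl⟩
    · exact ⟨P, q :: (R ++ [a]), by simp, hP, .inr ⟨q, _, rfl, hq⟩⟩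

theorem represents_completeOn_iff {n : ℕ} (w : List ℕ) (hw : w.toFinset = Finset.Icc 1 n) :
    Represents w (completeOn n) ↔ AlternatesOn (Set.Icc 1 n) w := by
  have hmem : ∀ x, x ∈ w ↔ 1 ≤ x ∧ x ≤ n := fun x => by
    rw [← List.mem_toFinset, hw, Finset.mem_Icc]
  simp only [Represents, completeOn, SimpleGraph.fromRel_adj, AlternatesOn, Set.mem_Icc, hmem]
  constructor
  · rintro ⟨-, h⟩ x hx y hy hxy
    exact (h x y hxy hx hy).1 ⟨hxy, .inl ⟨hx.1, hx.2, hy⟩⟩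
  · intro h
    refine ⟨by rintro x y ⟨-, h | h⟩ <;> omega, fun x y hxy hx hy => ?_⟩
    exact ⟨fun _ => h x hx y hy hxy, fun _ => ⟨hxy, .inl ⟨hx.1, hx.2, hy⟩⟩⟩

theorem eq_append_of_pairwise {a : ℕ} {B : List ℕ} (ha : a ∉ B)
    (h : B.Pairwise fun x y => ¬(x < a ∧ a < y)) :
    ∃ L S, B = L ++ S ∧ (∀ x ∈ L, a < x) ∧ ∀ x ∈ S, x < a := by
  induction B with
  | nil => exact ⟨[], [], rfl, by simp, by simp⟩
  | cons b B ih =>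
    rw [List.pairwise_cons] at h
    rw [List.mem_cons, not_or] at ha
    rcases lt_or_gt_of_ne ha.1 with hb | hb
    · obtain ⟨L, S, rfl, hL, hS⟩ := ih ha.2 h.2
      exact ⟨b :: L, S, rfl, by simpa [hb] using hL, hS⟩
    · refine ⟨[], b :: B, rfl, by simp, ?_⟩
      intro x hx
      rcases List.mem_cons.1 hx with rfl | hx
      · exact hb
      · have := h.1 x hx
        have : a ≠ x := fun e => ha.2 (e ▸ hx)
        omega

/-- The shape of a 132-avoiding word that consists of a permutation and its first letter. -/
theorem exists_eq_range'_append {n a : ℕ} {B : List ℕ} (hp : (a :: B).Perm (List.range' 1 n))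
    (hav : TriplewiseAvoids (a :: B ++ [a])) :
    ∃ i k S, n = i + (k + 1) ∧ S ∈ avoidingPerms i ∧ a = i + 1 ∧
      B = List.range' (i + 2) k ++ S := by
  have hnd : (a :: B).Nodup := hp.nodup_iff.2 List.nodup_range'
  rw [List.nodup_cons] at hnd
  simp only [TriplewiseAvoids, List.cons_append, List.triplewise_append, List.triplewise_cons,
    List.pairwise_append, List.mem_singleton, forall_eq] at hav
  obtain ⟨L, S, rfl, hL, hS⟩ := eq_append_of_pairwise (a := a) hnd.1
    (hav.2.2.2.2.imp fun {x y} h => by omega)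
  rw [← List.cons_append] at hp
  obtain ⟨h1, h2⟩ := perm_range'_of_append hp fun x hx y hy => by
    have := hS y hy
    rcases List.mem_cons.1 hx with rfl | hx
    · omega
    · have := hL x hx
      omega
  have hlen : L.length + S.length + 1 = n := by simpa using hp.length_eq
  have hLs : L.Pairwise (· ≤ ·) := by
    have h3 := hav.1.1
    rw [List.pairwise_append] at h3
    refine h3.1.imp_of_mem fun {x y} hx hy h => ?_
    have := hL x hx
    have := hL y hy
    omega
  have h4 := eq_range'_of_perm h1 (List.pairwise_cons.2 ⟨fun x hx => (hL x hx).le, hLs⟩)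
  rw [List.length_cons, List.range'_succ, List.cons.injEq] at h4
  have h5 : TriplewiseAvoids S := by
    have h6 := hav.2.1
    rw [List.triplewise_append] at h6
    exact h6.2.1
  refine ⟨S.length, L.length, S, by omega, mem_avoidingPerms.2 ⟨h2, h5⟩, by omega, ?_⟩
  rw [show S.length + 2 = 1 + S.length + 1 by omega, ← h4.2]

theorem eq_range'_of_forall_le {m q : ℕ} {S : List ℕ} (hp : (q :: S).Perm (List.range' 1 m))
    (hav : TriplewiseAvoids (q :: S)) (hq : ∀ x ∈ S, q ≤ x) : q :: S = List.range' 1 m := by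
  refine eq_range'_of_perm hp (List.pairwise_cons.2 ⟨hq, ?_⟩)
  have hnd : (q :: S).Nodup := hp.nodup_iff.2 List.nodup_range'
  rw [List.nodup_cons] at hnd
  rw [TriplewiseAvoids, List.triplewise_cons] at hav
  refine hav.1.imp_of_mem fun {x y} hx hy h => ?_
  have := hq y hy
  have : q ≠ y := fun e => hnd.1 (e ▸ hy)
  omega

theorem triplewiseAvoids_concat {w : List ℕ} {c : ℕ} : TriplewiseAvoids (w ++ [c]) ↔
    TriplewiseAvoids w ∧ w.Pairwise fun x y => ¬(x < c ∧ c < y) := by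
  simp [TriplewiseAvoids, List.triplewise_append]

theorem TriplewiseAvoids.pairwise {A R : List ℕ} {c : ℕ} (h : TriplewiseAvoids (A ++ c :: R)) :
    A.Pairwise fun x y => ¬(x < c ∧ c < y) :=
  (List.triplewise_append.1 h).2.2.2 c (by simp)

theorem AlternatesOn.rotate {n p : ℕ} {P R : List ℕ} (hP : P.Perm (List.range' 1 n))
    (hp : p ∈ P) (h : AlternatesOn (Set.Icc 1 n) (P ++ p :: R)) :
    ∃ B, P = p :: B ∧ (B ++ [p]).Perm (List.range' 1 n) ∧
      AlternatesOn (Set.Icc 1 n) ((B ++ [p]) ++ R) := by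
  obtain ⟨B, rfl, -⟩ := h.exists_eq_cons (hP.nodup_iff.2 List.nodup_range') hp fun x hx => by
    have := List.mem_range'_1.1 (hP.mem_iff.1 hx)
    exact ⟨this.1, by omega⟩
  exact ⟨B, rfl, (List.perm_append_singleton _ _).trans hP, by simpa using h.tail⟩

theorem perm_range'_of_toFinset {P : List ℕ} {n : ℕ} (hP : P.Nodup)
    (h : ∀ x, x ∈ P ↔ 1 ≤ x ∧ x ≤ n) : P.Perm (List.range' 1 n) := by
  rw [List.perm_ext_iff_of_nodup hP List.nodup_range']
  intro x
  rw [h, List.mem_range'_1]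
  omega

theorem triplewiseAvoids_range'_append {i k : ℕ} {S : List ℕ} (hS : S ∈ avoidingPerms i) :
    TriplewiseAvoids (List.range' (i + 1) k ++ S ++ [i + 1]) := by
  obtain ⟨hp, hav⟩ := mem_avoidingPerms.1 hS
  have hle : ∀ x ∈ S, x ≤ i := fun x hx => by
    have := List.mem_range'_1.1 (hp.mem_iff.1 hx)
    omega
  have hsorted : ∀ a, TriplewiseAvoids (List.range' a k) := fun a => by
    induction k generalizing a with
    | zero => simp
    | succ k ih =>
      rw [List.range'_succ, TriplewiseAvoids, List.triplewise_cons]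
      exact ⟨(List.pairwise_lt_range' (s := a + 1) (n := k)).imp fun h => by omega, ih _⟩
  rw [triplewiseAvoids_concat, TriplewiseAvoids, List.triplewise_append, List.pairwise_append]
  refine ⟨⟨hsorted _, hav, fun a ha => ?_, fun c hc => ?_⟩, ?_, ?_, ?_⟩
  · rw [List.mem_range'_1] at ha
    exact List.pairwise_of_forall_mem_list fun x hx y hy => by grind
  · exact List.pairwise_of_forall_mem_list fun x hx y hy => by
      rw [List.mem_range'_1] at hx
      have := hle c hc
      omega
  · exact List.pairwise_of_forall_mem_list fun x hx y hy => by
      rw [List.mem_range'_1] at hx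
      omega
  · exact List.pairwise_of_forall_mem_list fun x hx y hy => by
      have := hle y hy
      omega
  · intro x hx y hy
    rw [List.mem_range'_1] at hx
    omega

theorem perm_range'_append {i k : ℕ} {S : List ℕ} (hS : S ∈ avoidingPerms i) :
    (List.range' (i + 1) k ++ S).Perm (List.range' 1 (i + k)) := by
  rw [← List.range'_append_1, Nat.add_comm 1 i]
  exact ((mem_avoidingPerms.1 hS).1.append_left _).trans List.perm_append_comm

/-- The 132-avoiding words with letters `1, …, n` any two of which alternate. -/
def completeWords (n : ℕ) : Set (List ℕ) :=
  {w | TriplewiseAvoids w ∧ w.toFinset = Finset.Icc 1 n ∧ AlternatesOn (Set.Icc 1 n) w}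

theorem append_mem_completeWords {n : ℕ} {P Q : List ℕ} (hP : P.Perm (List.range' 1 n))
    (hQ : Q <+: P) (hav : TriplewiseAvoids (P ++ Q)) : P ++ Q ∈ completeWords n := by
  have hmem : ∀ x, x ∈ P ↔ 1 ≤ x ∧ x ≤ n := fun x => by
    rw [hP.mem_iff, List.mem_range'_1]
    omega
  refine ⟨hav, ?_, fun x hx y hy hxy => ?_⟩
  · ext x
    have : x ∈ Q → x ∈ P := fun h => hQ.subset h
    simp only [List.mem_toFinset, List.mem_append, Finset.mem_Icc, ← hmem]
    tauto
  · exact alternate_append_prefix (hP.nodup_iff.2 List.nodup_range') hQ ((hmem x).2 hx)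
      ((hmem y).2 hy) hxy

/-- An explicit list of the elements of `completeWords (m + 2)`. -/
def completeWordsFinset (m : ℕ) : Finset (List ℕ) :=
  avoidingPerms (m + 2) ∪
  ((Finset.range (m + 2)).biUnion fun i => (avoidingPerms i).image fun S =>
    List.range' (i + 1) (m + 2 - i) ++ S ++ [i + 1]) ∪
  (avoidingPerms m).image (fun S => (m + 1) :: (m + 2) :: (S ++ [m + 1, m + 2])) ∪
  {(m + 2) :: (List.range' 1 (m + 1) ++ [m + 2, 1]),
    (m + 1) :: (m + 2) :: (List.range' 1 m ++ [m + 1, m + 2, 1])}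

theorem mem_completeWordsFinset {m : ℕ} {w : List ℕ} : w ∈ completeWordsFinset m ↔
    w ∈ avoidingPerms (m + 2) ∨
    (∃ i < m + 2, ∃ S ∈ avoidingPerms i,
      List.range' (i + 1) (m + 2 - i) ++ S ++ [i + 1] = w) ∨
    (∃ S ∈ avoidingPerms m, (m + 1) :: (m + 2) :: (S ++ [m + 1, m + 2]) = w) ∨
    w = (m + 2) :: (List.range' 1 (m + 1) ++ [m + 2, 1]) ∨
    w = (m + 1) :: (m + 2) :: (List.range' 1 m ++ [m + 1, m + 2, 1]) := by
  simp only [completeWordsFinset, Finset.mem_union, Finset.mem_biUnion, Finset.mem_image,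
    Finset.mem_range, Finset.mem_insert, Finset.mem_singleton, or_assoc]

theorem range'_mem_avoidingPerms (m : ℕ) : List.range' 1 m ∈ avoidingPerms m := by
  have h0 : ([] : List ℕ) ∈ avoidingPerms 0 := mem_avoidingPerms.2 ⟨by simp, by simp⟩
  have h := triplewiseAvoids_range'_append (k := m) h0
  rw [triplewiseAvoids_concat] at h
  exact mem_avoidingPerms.2 ⟨List.Perm.refl _, by simpa using h.1⟩

theorem mem_completeWords_of_mem_finset {m : ℕ} (hm : 1 ≤ m) {w : List ℕ}
    (hw : w ∈ completeWordsFinset m) : w ∈ completeWords (m + 2) := by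
  have mem_le : ∀ {i : ℕ} {S : List ℕ}, S ∈ avoidingPerms i → ∀ x ∈ S, 1 ≤ x ∧ x ≤ i :=
    fun hS x hx => by
      have := List.mem_range'_1.1 ((mem_avoidingPerms.1 hS).1.mem_iff.1 hx)
      omega
  rcases mem_completeWordsFinset.1 hw with
    h | ⟨i, hi, S, hS, rfl⟩ | ⟨S, hS, rfl⟩ | rfl | rfl
  · obtain ⟨hp, hav⟩ := mem_avoidingPerms.1 h
    simpa using append_mem_completeWords hp List.nil_prefix (by simpa using hav)
  · obtain ⟨k, hk⟩ : ∃ k, m + 2 = i + (k + 1) := ⟨m + 1 - i, by omega⟩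
    rw [show m + 2 - i = k + 1 by omega]
    refine append_mem_completeWords (hk ▸ perm_range'_append hS) ?_
      (triplewiseAvoids_range'_append hS)
    simp [List.range'_succ]
  · have h1 := triplewiseAvoids_range'_append (k := 2) hS
    have h2 := append_mem_completeWords (Q := [m + 1, m + 2])
      (perm_range'_append (k := 2) hS) (by simp [List.range'_succ]) (by
        rw [show [m + 1, m + 2] = [m + 1] ++ [m + 2] from rfl, ← List.append_assoc,
          triplewiseAvoids_concat]
        refine ⟨h1, List.pairwise_of_forall_mem_list fun x hx y hy => ?_⟩
        have := mem_le hS y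
        simp [List.range'_succ] at hy
        grind)
    simpa [List.range'_succ] using h2
  · have hS := range'_mem_avoidingPerms (m + 1)
    have h1 := triplewiseAvoids_range'_append (k := 1) hS
    have h2 := append_mem_completeWords (Q := [m + 2, 1])
      (perm_range'_append (k := 1) hS) (by simp [List.range'_succ]) (by
        rw [show [m + 2, 1] = [m + 2] ++ [1] from rfl, ← List.append_assoc,
          triplewiseAvoids_concat]
        refine ⟨h1, List.pairwise_of_forall_mem_list fun x hx y hy => ?_⟩
        have := mem_le hS x
        simp [-List.mem_range'_1] at hx
        grind)
    simpa using h2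
  · have hS := range'_mem_avoidingPerms m
    have h1 := triplewiseAvoids_range'_append (k := 2) hS
    have h2 := append_mem_completeWords (Q := [m + 1, m + 2, 1])
      (perm_range'_append (k := 2) hS) (by
        obtain ⟨m, rfl⟩ := Nat.exists_eq_add_of_le' hm
        simp [List.range'_succ]) (by
        rw [show [m + 1, m + 2, 1] = [m + 1] ++ [m + 2] ++ [1] from rfl, ← List.append_assoc,
          ← List.append_assoc, triplewiseAvoids_concat, triplewiseAvoids_concat]
        refine ⟨⟨h1, List.pairwise_of_forall_mem_list fun x hx y hy => ?_⟩,
          List.pairwise_of_forall_mem_list fun x hx y hy => ?_⟩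
        · have := mem_le hS y
          simp [-List.mem_range'_1, List.range'_succ] at hy
          grind
        · have := mem_le hS x
          simp [-List.mem_range'_1, List.range'_succ] at hx
          grind)
    simpa [List.range'_succ] using h2

theorem mem_finset_of_mem_completeWords {m : ℕ} (hm : 1 ≤ m) {w : List ℕ}
    (hw : w ∈ completeWords (m + 2)) : w ∈ completeWordsFinset m := by
  obtain ⟨hav, hset, halt⟩ := hw
  have hmem : ∀ x, x ∈ w ↔ 1 ≤ x ∧ x ≤ m + 2 := fun x => by
    rw [← List.mem_toFinset, hset, Finset.mem_Icc]
  rw [mem_completeWordsFinset]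
  obtain ⟨P, Q, rfl, hnd, rfl | ⟨q, R, rfl, hq⟩⟩ := exists_maximal_nodup_prefix w
  · left
    rw [List.append_nil] at *
    exact mem_avoidingPerms.2 ⟨perm_range'_of_toFinset hnd hmem, hav⟩
  right
  have hPs : ∀ x ∈ P, x ∈ Set.Icc 1 (m + 2) := fun x hx => (hmem x).1 (by simp [hx])
  have hP : P.Perm (List.range' 1 (m + 2)) := by
    obtain ⟨-, -, hall⟩ := halt.exists_eq_cons hnd hq hPs
    exact perm_range'_of_toFinset hnd fun x => ⟨fun hx => hPs x hx, fun hx => hall x hx⟩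
  have hletter : ∀ x ∈ R, ∀ P' : List ℕ, P'.Perm (List.range' 1 (m + 2)) → x ∈ P' :=
    fun x hx P' hP' => by
      have := (hmem x).1 (by simp [hx])
      rw [hP'.mem_iff, List.mem_range'_1]
      omega
  obtain ⟨B, rfl, hB, haltB⟩ := halt.rotate hP hq
  obtain ⟨i, k, S, hik, hS, rfl, rfl⟩ := exists_eq_range'_append hP
    (List.triplewise_append.1
      (show TriplewiseAvoids (q :: B ++ [q] ++ R) by simpa using hav)).1
  have hSp := mem_avoidingPerms.1 hS
  have hSlen : S.length = i := by simpa using hSp.1.length_eq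
  have hSmem : ∀ x, x ∈ S ↔ 1 ≤ x ∧ x < 1 + i := fun x => by
    rw [hSp.1.mem_iff, List.mem_range'_1]
  cases R with
  | nil =>
    left
    refine ⟨i, by omega, S, hS, ?_⟩
    rw [show m + 2 - i = k + 1 by omega, List.range'_succ]
    simp
  | cons p R =>
  right
  obtain ⟨B₂, hB₂, hpB₂, halt₂⟩ := haltB.rotate hB (hletter p (by simp) _ hB)
  have hpw := TriplewiseAvoids.pairwise (R := R) (c := p)
    (A := (i + 1) :: (List.range' (i + 2) k ++ S) ++ [i + 1]) (by simpa using hav)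
  cases k with
  | zero =>
    obtain rfl : i = m + 1 := by omega
    cases S with
    | nil => simp at hSlen
    | cons s S =>
    simp only [List.range'_zero, List.nil_append, List.cons_append, List.cons.injEq] at hB₂
    obtain ⟨rfl, rfl⟩ := hB₂
    have hs := (hSmem s).1 (by simp)
    have hsorted := eq_range'_of_forall_le hSp.1 hSp.2 fun x hx => by
      simp [List.pairwise_append] at hpw
      grind
    have hs1 : s = 1 := by
      rw [List.range'_succ, List.cons.injEq] at hsorted
      exact hsorted.1
    cases R with
    | nil =>
      right; left
      rw [← hsorted, hs1]
      simp
    | cons r R =>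
    exfalso
    obtain ⟨B₃, hB₃, -, -⟩ := halt₂.rotate hpB₂ (hletter r (by simp) _ hpB₂)
    cases S with
    | nil => simp at hSlen; omega
    | cons s' S =>
    simp only [List.cons_append, List.cons.injEq] at hB₃
    obtain ⟨rfl, rfl⟩ := hB₃
    have hs' := (hSmem s').1 (by simp)
    have hne : s ≠ s' := by
      have := hSp.1.nodup_iff.2 List.nodup_range'
      simp at this
      tauto
    have hpw' := TriplewiseAvoids.pairwise (R := R) (c := s')
      (A := (m + 1 + 1) :: s :: (s' :: S) ++ [m + 1 + 1, s]) (by simpa using hav)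
    simp [List.pairwise_append] at hpw'
    grind
  | succ k =>
    rw [List.range'_succ] at hB₂
    simp only [List.cons_append, List.cons.injEq] at hB₂
    obtain ⟨rfl, rfl⟩ := hB₂
    cases k with
    | succ k =>
      exfalso
      simp [List.range'_succ] at hpw
    | zero =>
    obtain rfl : i = m := by omega
    cases R with
    | nil =>
      left
      exact ⟨S, hS, by simp⟩
    | cons q R =>
    right; right
    obtain ⟨B₃, hB₃, hpB₃, halt₃⟩ := halt₂.rotate hpB₂ (hletter q (by simp) _ hpB₂)
    cases S with
    | nil => simp at hSlen; omega
    | cons s S =>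
    simp only [List.range'_zero, List.nil_append, List.cons_append, List.cons.injEq] at hB₃
    obtain ⟨rfl, rfl⟩ := hB₃
    have hs := (hSmem s).1 (by simp)
    have hpw₂ := TriplewiseAvoids.pairwise (R := R) (c := s)
      (A := (i + 1) :: (i + 2) :: (s :: S) ++ [i + 1, i + 2]) (by simpa using hav)
    have hsorted := eq_range'_of_forall_le hSp.1 hSp.2 fun x hx => by
      simp [List.pairwise_append] at hpw₂
      grind
    have hs1 : s = 1 := by
      obtain ⟨j, rfl⟩ := Nat.exists_eq_add_of_le' hm
      rw [List.range'_succ, List.cons.injEq] at hsorted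
      exact hsorted.1
    cases R with
    | nil =>
      rw [← hsorted, hs1]
      simp
    | cons r R =>
    exfalso
    obtain ⟨B₄, hB₄, -, -⟩ := halt₃.rotate hpB₃ (hletter r (by simp) _ hpB₃)
    have hpw₃ := TriplewiseAvoids.pairwise (R := R) (c := r)
      (A := (i + 1) :: (i + 2) :: (s :: S) ++ [i + 1, i + 2, s]) (by simpa using hav)
    cases S with
    | nil =>
      simp at hB₄ hpw₃
      grind
    | cons s' S =>
      simp only [List.cons_append, List.cons.injEq] at hB₄
      obtain ⟨rfl, rfl⟩ := hB₄
      have hs' := (hSmem s').1 (by simp)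
      have hne : s ≠ s' := by
        have := hSp.1.nodup_iff.2 List.nodup_range'
        simp at this
        tauto
      simp [List.pairwise_append] at hpw₃
      grind

theorem card_completeWordsFinset (m : ℕ) : (completeWordsFinset m).card =
    2 + catalan m + ∑ i ∈ Finset.range (m + 2 + 1), catalan i := by
  have hlen : ∀ {i : ℕ} {S : List ℕ}, S ∈ avoidingPerms i → S.length = i := fun hS => by
    simpa using (mem_avoidingPerms.1 hS).1.length_eq
  have h1 : ((Finset.range (m + 2)).biUnion fun i => (avoidingPerms i).image fun S =>
      List.range' (i + 1) (m + 2 - i) ++ S ++ [i + 1]).card =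
      ∑ i ∈ Finset.range (m + 2), catalan i := by
    rw [Finset.card_biUnion]
    · refine Finset.sum_congr rfl fun i _ => ?_
      rw [Finset.card_image_of_injective _ fun S T h => by simpa using h, card_avoidingPerms]
    · intro i _ j _ hij
      rw [Function.onFun, Finset.disjoint_left]
      intro w hi hj
      rw [Finset.mem_image] at hi hj
      obtain ⟨S, -, rfl⟩ := hi
      obtain ⟨T, -, h⟩ := hj
      have := congrArg List.getLast? h
      simp at this
      exact hij this.symm
  have h2 : ((avoidingPerms m).image
      (fun S => (m + 1) :: (m + 2) :: (S ++ [m + 1, m + 2]))).card = catalan m := by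
    rw [Finset.card_image_of_injective _ fun S T h => by simpa using h, card_avoidingPerms]
  rw [completeWordsFinset, Finset.card_union_of_disjoint, Finset.card_union_of_disjoint,
    Finset.card_union_of_disjoint, h1, h2, card_avoidingPerms, Finset.card_pair,
    Finset.sum_range_succ _ (m + 2)]
  · ring
  · simp
  · rw [Finset.disjoint_left]
    intro w hw hw'
    simp only [Finset.mem_biUnion, Finset.mem_image, Finset.mem_range] at hw'
    obtain ⟨i, hi, S, hS, rfl⟩ := hw'
    have h3 := hlen hw
    have h4 := hlen hS
    simp at h3
    omega
  · rw [Finset.disjoint_left]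
    intro w hw hw'
    simp only [Finset.mem_biUnion, Finset.mem_image, Finset.mem_range, Finset.mem_union]
      at hw hw'
    obtain ⟨T, hT, rfl⟩ := hw'
    have h5 := hlen hT
    rcases hw with hw | ⟨i, hi, S, hS, h⟩
    · have h3 := hlen hw
      simp at h3
      omega
    · have h3 := congrArg List.length h
      have h4 := hlen hS
      simp at h3
      omega
  · rw [Finset.disjoint_left]
    intro w hw hw'
    simp only [Finset.mem_biUnion, Finset.mem_image, Finset.mem_range, Finset.mem_union] at hw
    have hw2 : w.length = m + 5 ∨ (w.length = m + 4 ∧ w.head? = some (m + 2)) := by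
      simp only [Finset.mem_insert, Finset.mem_singleton] at hw'
      rcases hw' with rfl | rfl <;> simp
    rcases hw with (hw | ⟨i, hi, S, hS, rfl⟩) | ⟨S, hS, rfl⟩
    · have h3 := hlen hw
      omega
    · have h4 := hlen hS
      simp at hw2
      omega
    · have h4 := hlen hS
      simp at hw2
      omega

/-- For `n ≥ 3`, the number of 132-avoiding words with letter set `{1, …, n}`
representing the complete graph `K n` equals `2 + C (n-2) + ∑_{i=0}^{n} C i`,
where `C m` is the `m`-th Catalan number. -/
theorem card_representants_complete (n : ℕ) (hn : 3 ≤ n) :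
    {w : List ℕ | Avoids132 w ∧ w.toFinset = Finset.Icc 1 n ∧
      Represents w (completeOn n)}.ncard =
    2 + catalan (n - 2) + ∑ i ∈ Finset.range (n + 1), catalan i := by
  obtain ⟨m, rfl⟩ : ∃ m, n = m + 2 := ⟨n - 2, by omega⟩
  rw [Nat.add_sub_cancel, ← card_completeWordsFinset, ← Set.ncard_coe_finset]
  congr 1
  ext w
  rw [Finset.mem_coe]
  have h : w ∈ completeWordsFinset m ↔ w ∈ completeWords (m + 2) :=
    ⟨mem_completeWords_of_mem_finset (by omega), mem_finset_of_mem_completeWords (by omega)⟩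
  rw [h, Set.mem_ofPred_eq, avoids132_iff_triplewiseAvoids]
  exact and_congr_right fun _ => and_congr_right fun hw => represents_completeOn_iff w hw
end
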